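/- arXiv:1309.6790 — 2 statements merged into one kernel-verified Lean document; each statement's English description precedes it below -/
import Mathlib

section
/- (Necessary condition for distributed sufficiency, discrete case.) Work in the two-phase factored model where each X_i and each Y_i takes values in a countable set equipped with counting measure, and the space of Y_i equals the space of X_i. For each i let q_i(x_i | g_i(η)) be a working probability mass function and S_i a statistic on the space of X_i that is sufficient for g_i(η) under q_i (factorization criterion). Suppose that for every observation model of product form p_obs(y | x, ξ) = ∏_{i=1}^r p_i(y_i | x_i, ξ_i) (probability mass functions in y_i), every collection T(Y) = (T_1(Y_1), ..., T_r(Y_r)) of statistics with each T_i sufficient for (g_i(η), ξ_i) under the induced working marginal ∑_{x_i} p_i(y_i | x_i, ξ_i) q_i(x_i | g_i(η)) is jointly sufficient for (θ, ξ) under the induced marginal p_Y(y | θ, ξ) = ∑_x [∏_i p_i(y_i | x_i, ξ_i)] p_X(x | θ). Then the collection S(X) = (S_1(X_1), ..., S_r(X_r)) is sufficient for θ under the scientific model p_X(x | θ); i.e., there exist a nonnegative function h(x) and a nonnegative function f such that p_X(x | θ) = h(x) · f(S_1(x_1), ..., S_r(x_r), θ) for all x and θ. (The proof specializes the hypothesis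 to the degenerate observation model p_i(y_i | x_i, ξ) = 1{y_i = x_i}.) -/
open scoped ENNReal

/-- **Necessary condition for distributed sufficiency (discrete case).**
If for *every* product-form observation model and *every* collection of statistics
`T i` individually sufficient for `(g i η, ξ i)` under the induced working marginals,
the collection `T` is jointly sufficient for `(θ, ξ)` under the induced marginal of
the raw data, then the collection `S` of individual working-model-sufficient statistics
must be sufficient for `θ` under the scientific model `pX`.  (The proof specializes to
the degenerate observation model `p i y x ξ = 1{y = x}`.) -/
theorem necessary_condition_distributed_sufficiency
    {ι : Type} [Fintype ι]
    -- countable scientific-variable spaces; raw data live on the same spaces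
    {X : ι → Type} [∀ i, Countable (X i)]
    -- parameter spaces: scientific θ, nonempty nuisance components ξ i, working η
    {Θ : Type} {Ξ : ι → Type} [∀ i, Nonempty (Ξ i)] {H : Type} {Γ : ι → Type}
    (g : ∀ i, H → Γ i)
    -- working probability mass functions q i (x i | g i η)
    (q : ∀ i, X i → Γ i → ℝ≥0∞)
    (hq_prob : ∀ i η, ∑' x : X i, q i x (g i η) = 1)
    -- the scientific probability mass function pX (x | θ)
    (pX : (∀ i, X i) → Θ → ℝ≥0∞)
    (hpX_prob : ∀ θ, ∑' x : ∀ i, X i, pX x θ = 1)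
    -- statistics S i, each sufficient for g i η under the working model q i
    {𝒮 : ι → Type} (S : ∀ i, X i → 𝒮 i)
    (hS_suff : ∀ i, ∃ (hS : X i → ℝ≥0∞) (fS : 𝒮 i → Γ i → ℝ≥0∞),
      ∀ (x : X i) (η : H), q i x (g i η) = hS x * fS (S i x) (g i η))
    -- hypothesis: for every product-form observation model (pmfs in y i) and every
    -- collection of statistics T i individually sufficient for (g i η, ξ i) under the
    -- induced working marginals, T is jointly sufficient for (θ, ξ) under the induced
    -- marginal p_Y (y | θ, ξ) = ∑ₓ (∏ i, p i (y i) (x i) (ξ i)) · pX x θ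
    (hyp : ∀ (p : ∀ i, X i → X i → Ξ i → ℝ≥0∞),
      (∀ i (x : X i) (ξi : Ξ i), ∑' y : X i, p i y x ξi = 1) →
      ∀ (𝒯 : ι → Type) (T : ∀ i, X i → 𝒯 i),
      (∀ i, ∃ (hT : X i → ℝ≥0∞) (fT : 𝒯 i → Γ i → Ξ i → ℝ≥0∞),
        ∀ (y : X i) (η : H) (ξi : Ξ i),
          ∑' x : X i, p i y x ξi * q i x (g i η) = hT y * fT (T i y) (g i η) ξi) →
      ∃ (hJ : (∀ i, X i) → ℝ≥0∞) (fJ : (∀ i, 𝒯 i) → Θ → (∀ i, Ξ i) → ℝ≥0∞),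
        ∀ (y : ∀ i, X i) (θ : Θ) (ξ : ∀ i, Ξ i),
          ∑' x : ∀ i, X i, (∏ i, p i (y i) (x i) (ξ i)) * pX x θ
            = hJ y * fJ (fun i => T i (y i)) θ ξ) :
    -- conclusion: S is sufficient for θ under the scientific model pX
    ∃ (h : (∀ i, X i) → ℝ≥0∞) (f : (∀ i, 𝒮 i) → Θ → ℝ≥0∞),
      ∀ (x : ∀ i, X i) (θ : Θ), pX x θ = h x * f (fun i => S i (x i)) θ := by
  classical
  obtain ⟨h, f, hf⟩ := hyp (fun i y x _ => if y = x then 1 else 0)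
    (fun i x _ => tsum_ite_eq x _) 𝒮 S (fun i => by
      obtain ⟨hS, fS, hfac⟩ := hS_suff i
      refine ⟨hS, fun s γ _ => fS s γ, fun y η _ => ?_⟩
      rw [tsum_eq_single y (fun x hx => by simp [hx.symm]), ← hfac y η]
      simp)
  refine ⟨h, fun s θ => f s θ (fun _ => Classical.arbitrary _), fun x θ => ?_⟩
  rw [← hf x θ, tsum_eq_single x]
  · simp
  · intro x' hx'
    obtain ⟨i, hi⟩ := Function.ne_iff.mp hx'
    rw [Finset.prod_eq_zero (Finset.mem_univ i) (if_neg hi.symm), zero_mul]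
end

section
/- (Sufficiency preservation does not guarantee distributed lossless compression.) Fix n ≥ 1 and m ≥ 2. Let μ₁, ..., μₙ be i.i.d. N(θ, 1) for θ ∈ ℝ, and, given μ = (μ₁, ..., μₙ), let y_{ij} for i = 1, ..., n, j = 1, ..., m be conditionally independent with y_{ij} | μ_i distributed as a standard Cauchy distribution with location μ_i (equivalently, y_{ij} | μ_i, σ_{ij}² ~ N(μ_i, σ_{ij}²) with σ_{ij}² i.i.d. inverse-chi-squared with 1 degree of freedom, marginalized over the σ_{ij}²). Let p(y | θ) denote the resulting joint density of y = (y_{ij}) with respect to Lebesgue measure on ℝ^{nm}. Then the vector of sample means (ȳ₁, ..., ȳₙ), where ȳ_i = (1/m)Σ_{j=1}^m y_{ij}, is NOT sufficient for θ: there exist no nonnegative measurable functions h and f with p(y | θ) = h(y) · f(ȳ₁, ..., ȳₙ, θ) for Lebesgue-a.e. y and all θ ∈ ℝ. -/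
open MeasureTheory
open scoped ENNReal

open ProbabilityTheory Filter Topology

/-- The joint density at `v` of conditionally independent standard Cauchy variables
with common location `s`. -/
noncomputable def cauchyLikelihood {m : ℕ} (v : Fin m → ℝ) (s : ℝ) : ℝ :=
  ∏ j, 1 / (Real.pi * (1 + (v j - s) ^ 2))

/-- The marginal density of a row of observations, the location being `N(θ, 1)`. -/
noncomputable def rowDensity {m : ℕ} (v : Fin m → ℝ) (θ : ℝ) : ℝ :=
  ∫ s, cauchyLikelihood v s ∂gaussianReal θ 1

lemma cauchyLikelihood_pos {m : ℕ} (v : Fin m → ℝ) (s : ℝ) : 0 < cauchyLikelihood v s :=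
  Finset.prod_pos fun _ _ => by positivity

lemma cauchy_factor_le_one (x : ℝ) : 1 / (Real.pi * (1 + x ^ 2)) ≤ 1 := by
  rw [div_le_one (by positivity)]
  nlinarith [Real.pi_gt_three, sq_nonneg x]

lemma cauchyLikelihood_le_one {m : ℕ} (v : Fin m → ℝ) (s : ℝ) : cauchyLikelihood v s ≤ 1 :=
  Finset.prod_le_one (fun _ _ => by positivity) fun _ _ => cauchy_factor_le_one _

lemma Continuous.cauchyLikelihood {X : Type*} [TopologicalSpace X] {m : ℕ} {v : X → Fin m → ℝ}
    {s : X → ℝ} (hv : Continuous v) (hs : Continuous s) :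
    Continuous fun x => cauchyLikelihood (v x) (s x) := by
  unfold _root_.cauchyLikelihood
  refine continuous_finsetProd _ fun j _ => ?_
  exact Continuous.div (by fun_prop) (by fun_prop) fun x => by positivity

lemma continuous_cauchyLikelihood_right {m : ℕ} (v : Fin m → ℝ) :
    Continuous (cauchyLikelihood v) :=
  continuous_const.cauchyLikelihood continuous_id

lemma norm_cauchyLikelihood_le_one {m : ℕ} (v : Fin m → ℝ) (s : ℝ) :
    ‖cauchyLikelihood v s‖ ≤ 1 := by
  rw [Real.norm_of_nonneg (cauchyLikelihood_pos v s).le]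
  exact cauchyLikelihood_le_one v s

lemma integrable_cauchyLikelihood {m : ℕ} (v : Fin m → ℝ) (μ : Measure ℝ) [IsFiniteMeasure μ] :
    Integrable (cauchyLikelihood v) μ :=
  Integrable.of_bound (continuous_cauchyLikelihood_right v).aestronglyMeasurable 1
    (ae_of_all _ (norm_cauchyLikelihood_le_one v))

lemma rowDensity_pos {m : ℕ} (v : Fin m → ℝ) (θ : ℝ) : 0 < rowDensity v θ := by
  refine (integral_pos_iff_support_of_nonneg (fun s => (cauchyLikelihood_pos v s).le)
    (integrable_cauchyLikelihood v _)).2 ?_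
  have : Function.support (cauchyLikelihood v) = Set.univ :=
    Set.eq_univ_of_forall fun s => (cauchyLikelihood_pos v s).ne'
  simp [this]

lemma continuous_rowDensity {m : ℕ} (θ : ℝ) :
    Continuous fun v : Fin m → ℝ => rowDensity v θ :=
  continuous_of_dominated (bound := fun _ => 1)
    (fun v => (continuous_cauchyLikelihood_right v).aestronglyMeasurable)
    (fun v => ae_of_all _ (norm_cauchyLikelihood_le_one v)) (integrable_const _)
    (ae_of_all _ fun _ => continuous_id.cauchyLikelihood continuous_const)

/-- The joint density of the observations is the product of the row densities. -/
lemma lintegral_prod_eq_ofReal_prod_rowDensity {n m : ℕ} (y : Fin n → Fin m → ℝ) (θ : ℝ) :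
    ∫⁻ μvec : Fin n → ℝ,
        ∏ i, (ENNReal.ofReal
            (Real.exp (-(μvec i - θ) ^ 2 / 2) / Real.sqrt (2 * Real.pi)) *
          ∏ j, ENNReal.ofReal (1 / (Real.pi * (1 + (y i j - μvec i) ^ 2)))) =
      ENNReal.ofReal (∏ i, rowDensity (y i) θ) := by
  have hint : ∀ i, Integrable fun s => gaussianPDFReal θ 1 s * cauchyLikelihood (y i) s :=
    fun i => (integrable_gaussianPDFReal θ 1).mul_bdd (c := 1)
      (continuous_cauchyLikelihood_right (y i)).aestronglyMeasurable
      (ae_of_all _ (norm_cauchyLikelihood_le_one (y i)))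
  have hrow : ∀ i, rowDensity (y i) θ = ∫ s, gaussianPDFReal θ 1 s * cauchyLikelihood (y i) s :=
    fun i => by
      simp [rowDensity, integral_gaussianReal_eq_integral_smul (one_ne_zero : (1 : NNReal) ≠ 0)]
  have hnonneg : ∀ i s, 0 ≤ gaussianPDFReal θ 1 s * cauchyLikelihood (y i) s := fun i s =>
    mul_nonneg (gaussianPDFReal_nonneg _ _ _) (cauchyLikelihood_pos _ _).le
  simp_rw [hrow]
  rw [← integral_fintype_prod_volume_eq_prod
      (fun i s => gaussianPDFReal θ 1 s * cauchyLikelihood (y i) s),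
    volume_pi, ofReal_integral_eq_lintegral_ofReal (Integrable.fintype_prod hint)
      (ae_of_all _ fun s => Finset.prod_nonneg fun i _ => hnonneg i (s i))]
  refine lintegral_congr fun s => ?_
  rw [ENNReal.ofReal_prod_of_nonneg fun i _ => hnonneg i (s i)]
  refine Finset.prod_congr rfl fun i _ => ?_
  rw [ENNReal.ofReal_mul (gaussianPDFReal_nonneg _ _ _), cauchyLikelihood,
    ENNReal.ofReal_prod_of_nonneg fun j _ => by positivity]
  congr 2
  simp [gaussianPDFReal, div_eq_inv_mul]

lemma integrable_one_add_sq_pow_gaussianReal (m : ℕ) :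
    Integrable (fun s : ℝ => (1 + s ^ 2) ^ m) (gaussianReal 0 1) := by
  have hid : MemLp (id : ℝ → ℝ) ((2 * m : ℕ) : ℝ≥0∞) (gaussianReal 0 1) := by
    simpa using memLp_id_gaussianReal (μ := 0) (v := 1) ((2 * m : ℕ) : NNReal)
  have hconst : MemLp (fun _ : ℝ => (1 : ℝ)) ((2 * m : ℕ) : ℝ≥0∞) (gaussianReal 0 1) :=
    memLp_const 1
  have h := (hconst.add hid.norm).integrable_norm_pow'
  simp only [Pi.add_apply, id_eq] at h
  refine h.mono' (by fun_prop) (ae_of_all _ fun s => ?_)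
  rw [Real.norm_of_nonneg (by positivity), Real.norm_of_nonneg (by positivity), pow_mul]
  refine pow_le_pow_left₀ (by positivity) ?_ m
  rw [Real.norm_eq_abs, ← sq_abs s]
  nlinarith [abs_nonneg s]

lemma one_add_sq_sub_le (a b : ℝ) : 1 + (a - b) ^ 2 ≤ 2 * (1 + a ^ 2) * (1 + b ^ 2) := by
  nlinarith [sq_nonneg (a + b), sq_nonneg (a * b)]

/-- As the prior mean goes to infinity, the row density has the polynomial tail of the Cauchy
likelihood, with a constant that does not depend on the observations. -/
lemma tendsto_mul_rowDensity_atTop {m : ℕ} (v : Fin m → ℝ) :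
    Tendsto (fun θ => (Real.pi * (1 + θ ^ 2)) ^ m * rowDensity v θ) atTop (𝓝 1) := by
  have hshift : ∀ θ, (Real.pi * (1 + θ ^ 2)) ^ m * rowDensity v θ =
      ∫ s, ∏ j, (1 + θ ^ 2) / (1 + (v j - (s + θ)) ^ 2) ∂gaussianReal 0 1 := by
    intro θ
    have hmap : gaussianReal θ 1 = (gaussianReal 0 1).map (· + θ) := by
      rw [gaussianReal_map_add_const, zero_add]
    rw [rowDensity, hmap, integral_map (by fun_prop)
      (continuous_cauchyLikelihood_right v).aestronglyMeasurable, ← integral_const_mul]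
    refine integral_congr_ae (ae_of_all _ fun s => ?_)
    have hpow : (Real.pi * (1 + θ ^ 2)) ^ m = ∏ _j : Fin m, Real.pi * (1 + θ ^ 2) := by simp
    simp only [cauchyLikelihood]
    rw [hpow, ← Finset.prod_mul_distrib]
    refine Finset.prod_congr rfl fun j _ => ?_
    have : 1 + (v j - (s + θ)) ^ 2 ≠ 0 := by positivity
    field_simp
  simp_rw [hshift]
  suffices Tendsto (fun θ => ∫ s, ∏ j, (1 + θ ^ 2) / (1 + (v j - (s + θ)) ^ 2) ∂gaussianReal 0 1)
      atTop (𝓝 (∫ _s, (1 : ℝ) ∂gaussianReal 0 1)) by simpa using this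
  refine tendsto_integral_filter_of_dominated_convergence
    (fun s => (∏ j, 4 * (1 + v j ^ 2)) * (1 + s ^ 2) ^ m) (Eventually.of_forall fun θ => ?_)
    (Eventually.of_forall fun θ => ae_of_all _ fun s => ?_)
    ((integrable_one_add_sq_pow_gaussianReal m).const_mul _) (ae_of_all _ fun s => ?_)
  · exact Measurable.aestronglyMeasurable (by fun_prop)
  · have hpow : (1 + s ^ 2) ^ m = ∏ _j : Fin m, (1 + s ^ 2) := by simp
    rw [Real.norm_of_nonneg (Finset.prod_nonneg fun _ _ => by positivity), hpow,
      ← Finset.prod_mul_distrib]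
    refine Finset.prod_le_prod (fun _ _ => by positivity) fun j _ => ?_
    rw [div_le_iff₀ (by positivity)]
    calc 1 + θ ^ 2 = 1 + ((v j - s) - (v j - (s + θ))) ^ 2 := by ring
      _ ≤ 2 * (1 + (v j - s) ^ 2) * (1 + (v j - (s + θ)) ^ 2) := one_add_sq_sub_le _ _
      _ ≤ 2 * (2 * (1 + v j ^ 2) * (1 + s ^ 2)) * (1 + (v j - (s + θ)) ^ 2) := by
        gcongr
        exact one_add_sq_sub_le _ _
      _ = _ := by ring
  · have hfactor : ∀ c : ℝ,
        Tendsto (fun θ : ℝ => (1 + θ ^ 2) / (1 + (c - θ) ^ 2)) atTop (𝓝 1) := by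
      intro c
      have hinv : Tendsto (fun θ : ℝ => θ⁻¹) atTop (𝓝 0) := tendsto_inv_atTop_zero
      have hlim : Tendsto (fun θ : ℝ => (θ⁻¹ ^ 2 + 1) / (θ⁻¹ ^ 2 + (c * θ⁻¹ - 1) ^ 2)) atTop
          (𝓝 ((0 ^ 2 + 1) / (0 ^ 2 + (c * 0 - 1) ^ 2))) :=
        ((hinv.pow 2).add_const 1).div
          ((hinv.pow 2).add (((hinv.const_mul c).sub_const 1).pow 2)) (by norm_num)
      norm_num at hlim
      refine hlim.congr' ?_
      filter_upwards [eventually_gt_atTop 0] with θ hθ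
      have h1 : 1 + (c - θ) ^ 2 ≠ 0 := by positivity
      have h2 : (θ ^ 2)⁻¹ + (c * θ⁻¹ - 1) ^ 2 ≠ 0 := by positivity
      rw [div_eq_div_iff h2 h1]
      field_simp
    have hprod := tendsto_finsetProd Finset.univ fun j (_ : j ∈ Finset.univ) => hfactor (v j - s)
    simpa [sub_sub] using hprod

/-- Some displacement with zero sum strictly decreases the row density from its value at zero. -/
lemma exists_sum_eq_zero_rowDensity_lt {m : ℕ} (hm : 2 ≤ m) (θ : ℝ) :
    ∃ d : Fin m → ℝ, ∑ j, d j = 0 ∧ rowDensity d θ < rowDensity (0 : Fin m → ℝ) θ := by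
  obtain ⟨k, rfl⟩ := Nat.exists_eq_add_of_le' hm
  obtain ⟨t, ht⟩ := exists_gt (1 / rowDensity (0 : Fin (k + 2) → ℝ) θ)
  have hpos := rowDensity_pos (0 : Fin (k + 2) → ℝ) θ
  refine ⟨Fin.cons t (Fin.cons (-t) 0), by simp [Fin.sum_univ_succ], ?_⟩
  have ht0 : 0 < t := lt_trans (by positivity) ht
  have hbound : ∀ s, cauchyLikelihood (Fin.cons t (Fin.cons (-t) 0) : Fin (k + 2) → ℝ) s ≤
      1 / (1 + t ^ 2) := by
    intro s
    have htail : ∏ _j : Fin k, 1 / (Real.pi * (1 + (0 - s) ^ 2)) ≤ 1 :=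
      Finset.prod_le_one (fun _ _ => by positivity) fun _ _ => cauchy_factor_le_one _
    have hhead : 1 / (Real.pi * (1 + (t - s) ^ 2)) * (1 / (Real.pi * (1 + (-t - s) ^ 2))) ≤
        1 / (1 + t ^ 2) := by
      rw [div_mul_div_comm, one_mul]
      refine one_div_le_one_div_of_le (by positivity) ?_
      have hpi : 1 ≤ Real.pi := by linarith [Real.pi_gt_three]
      calc 1 + t ^ 2 ≤ (1 + (t - s) ^ 2) * (1 + (-t - s) ^ 2) := by
            nlinarith [sq_nonneg s, sq_nonneg t, sq_nonneg ((t - s) * (-t - s))]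
        _ ≤ _ := by
            gcongr <;> exact le_mul_of_one_le_left (by positivity) hpi
    have heq : cauchyLikelihood (Fin.cons t (Fin.cons (-t) 0) : Fin (k + 2) → ℝ) s =
        1 / (Real.pi * (1 + (t - s) ^ 2)) * (1 / (Real.pi * (1 + (-t - s) ^ 2))) *
          ∏ _j : Fin k, 1 / (Real.pi * (1 + (0 - s) ^ 2)) := by
      rw [cauchyLikelihood, Fin.prod_univ_succ, Fin.prod_univ_succ, mul_assoc]
      rfl
    rw [heq]
    exact (mul_le_of_le_one_right (by positivity) htail).trans hhead
  calc rowDensity _ θ ≤ ∫ _s, 1 / (1 + t ^ 2) ∂gaussianReal θ 1 :=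
        integral_mono (integrable_cauchyLikelihood _ _) (integrable_const _) hbound
    _ = 1 / (1 + t ^ 2) := by simp
    _ < rowDensity 0 θ := by
        rw [div_lt_iff₀ hpos] at ht
        rw [div_lt_iff₀ (by positivity)]
        nlinarith [sq_nonneg (t - 1)]

/-- **Sufficiency preservation does not guarantee distributed lossless compression.**
Let `μ_i ~ N(θ, 1)` i.i.d. and, given `μ`, let `y i j` be conditionally independent
standard Cauchy with location `μ i` (the marginal of `N(μ i, σ²)` over inverse-χ²₁
variances).  Then the vector of sample means `(ȳ 1, …, ȳ n)` is NOT sufficient for `θ`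
under the resulting joint density: no factorization `p(y | θ) = h(y)·f(ȳ, θ)` exists. -/
theorem sample_means_not_sufficient_for_cauchy_mixture
    (n m : ℕ) (hn : 1 ≤ n) (hm : 2 ≤ m) :
    -- the joint density of y = (y i j) with respect to Lebesgue measure on ℝ^{nm}
    let pdens : (Fin n → Fin m → ℝ) → ℝ → ℝ≥0∞ := fun y θ =>
      ∫⁻ μvec : Fin n → ℝ,
        ∏ i, (ENNReal.ofReal
            (Real.exp (-(μvec i - θ) ^ 2 / 2) / Real.sqrt (2 * Real.pi)) *
          ∏ j, ENNReal.ofReal (1 / (Real.pi * (1 + (y i j - μvec i) ^ 2))))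
    -- the vector of sample means is not sufficient for θ
    ¬ ∃ (h : (Fin n → Fin m → ℝ) → ℝ≥0∞) (f : (Fin n → ℝ) → ℝ → ℝ≥0∞),
        Measurable h ∧ (∀ θ, Measurable fun t => f t θ) ∧
        ∀ θ : ℝ, ∀ᵐ y ∂(volume : Measure (Fin n → Fin m → ℝ)),
          pdens y θ = h y * f (fun i => (∑ j, y i j) / m) θ := by
  intro pdens
  rintro ⟨h, f, -, -, hfac⟩
  obtain ⟨d, hd, hlt⟩ := exists_sum_eq_zero_rowDensity_lt hm 0
  set P : (Fin n → Fin m → ℝ) → ℝ → ℝ := fun y θ => ∏ i, rowDensity (y i) θ with hP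
  have hPpos : ∀ y θ, 0 < P y θ := fun y θ => Finset.prod_pos fun i _ => rowDensity_pos _ _
  have hPcont : ∀ θ, Continuous fun y => P y θ := fun θ =>
    continuous_finsetProd _ fun i _ => (continuous_rowDensity θ).comp (continuous_apply i)
  have hpdens : ∀ y θ, pdens y θ = ENNReal.ofReal (P y θ) :=
    lintegral_prod_eq_ofReal_prod_rowDensity
  let D : Fin n → Fin m → ℝ := fun _ => d
  have hmean : ∀ y : Fin n → Fin m → ℝ,
      (fun i => (∑ j, (y + D) i j) / (m : ℝ)) = fun i => (∑ j, y i j) / (m : ℝ) := by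
    intro y
    funext i
    simp [D, Finset.sum_add_distrib, hd]
  have hshift : ∀ θ, ∀ᵐ y ∂(volume : Measure (Fin n → Fin m → ℝ)),
      pdens (y + D) θ = h (y + D) * f (fun i => (∑ j, y i j) / m) θ := by
    intro θ
    have := (measurePreserving_add_right volume D).quasiMeasurePreserving.ae (hfac θ)
    filter_upwards [this] with y hy
    rw [hy, hmean]
  have hcross : ∀ θ, (fun y => P y θ * P (y + D) 0) = fun y => P (y + D) θ * P y 0 := by
    intro θ
    have hadd : Continuous fun y : Fin n → Fin m → ℝ => y + D := by fun_prop
    refine (Continuous.ae_eq_iff_eq (volume : Measure (Fin n → Fin m → ℝ))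
      ((hPcont θ).mul ((hPcont 0).comp hadd)) (((hPcont θ).comp hadd).mul (hPcont 0))).1 ?_
    filter_upwards [hfac θ, hfac 0, hshift θ, hshift 0] with y h1 h2 h3 h4
    have key : pdens y θ * pdens (y + D) 0 = pdens (y + D) θ * pdens y 0 := by
      rw [h1, h2, h3, h4]
      ring
    simp only [hpdens] at key
    rw [← ENNReal.ofReal_mul (hPpos _ _).le, ← ENNReal.ofReal_mul (hPpos _ _).le] at key
    exact (ENNReal.ofReal_eq_ofReal_iff (mul_pos (hPpos _ _) (hPpos _ _)).le
      (mul_pos (hPpos _ _) (hPpos _ _)).le).1 key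
  have hzero : ∀ θ, rowDensity (0 : Fin m → ℝ) θ ^ n * rowDensity d 0 ^ n =
      rowDensity d θ ^ n * rowDensity (0 : Fin m → ℝ) 0 ^ n := by
    intro θ
    simpa [hP, D] using congrFun (hcross θ) 0
  have hl := ((tendsto_mul_rowDensity_atTop (0 : Fin m → ℝ)).pow n).mul_const (rowDensity d 0 ^ n)
  have hr := ((tendsto_mul_rowDensity_atTop d).pow n).mul_const
    (rowDensity (0 : Fin m → ℝ) 0 ^ n)
  have heq : rowDensity d 0 ^ n = rowDensity (0 : Fin m → ℝ) 0 ^ n := by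
    have := tendsto_nhds_unique (hl.congr fun θ => by
      rw [mul_pow, mul_assoc, hzero, ← mul_assoc, ← mul_pow]) hr
    simpa using this
  exact (pow_lt_pow_left₀ hlt (rowDensity_pos d 0).le (by omega)).ne heq
end
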